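/- arXiv:2012.09817 — 4 statements merged into one kernel-verified Lean document; each statement's English description precedes it below -/
import Mathlib

section
/- (Świerczkowski) The rotation group SO(3) contains a free subgroup of rank two. Specifically, let φ be the rotation about the z-axis by angle arccos(1/3) and ρ the rotation about the x-axis by angle arccos(1/3); then the subgroup of SO(3) generated by φ and ρ is a free group on the two generators φ and ρ. -/
namespace Swierczkowski

open Matrix

/-- The rotation about the `z`-axis (for `true`) or the `x`-axis (for `false`) by `arccos (1/3)`. -/
noncomputable def rotationMatrix : Bool → Matrix (Fin 3) (Fin 3) ℝ
  | true => !![1/3, -(2*Real.sqrt 2)/3, 0; (2*Real.sqrt 2)/3, 1/3, 0; 0, 0, 1]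
  | false => !![1, 0, 0; 0, 1/3, -(2*Real.sqrt 2)/3; 0, (2*Real.sqrt 2)/3, 1/3]

theorem rotationMatrix_mul_transpose (b : Bool) :
    rotationMatrix b * (rotationMatrix b)ᵀ = 1 := by
  have h : √2 * √2 = (2 : ℝ) := Real.mul_self_sqrt (by norm_num)
  cases b <;> ext i j <;> fin_cases i <;> fin_cases j <;>
    simp [rotationMatrix, Matrix.mul_apply, Fin.sum_univ_three] <;> linarith

theorem rotationMatrix_mem_specialOrthogonalGroup (b : Bool) :
    rotationMatrix b ∈ specialOrthogonalGroup (Fin 3) ℝ := by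
  have h : √2 * √2 = (2 : ℝ) := Real.mul_self_sqrt (by norm_num)
  refine mem_specialOrthogonalGroup_iff.2
    ⟨(mem_orthogonalGroup_iff _ _).2 (rotationMatrix_mul_transpose b), ?_⟩
  cases b <;> simp [rotationMatrix, det_fin_three] <;> linarith

/-- `rotationMatrix` as an invertible matrix, with inverse the transpose. -/
noncomputable def rotation (b : Bool) : GL (Fin 3) ℝ where
  val := rotationMatrix b
  inv := (rotationMatrix b)ᵀ
  val_inv := rotationMatrix_mul_transpose b
  inv_val := mul_eq_one_comm.1 (rotationMatrix_mul_transpose b)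

/-- The rotation, or its inverse, attached to a letter of a word. -/
noncomputable def letterRotation (x : Bool × Bool) : GL (Fin 3) ℝ :=
  cond x.2 (rotation x.1) (rotation x.1)⁻¹

/-- Three times the matrix of `letterRotation x` in the basis `(1, 0, 0), (0, √2, 0), (0, 0, 1)`. -/
def integralMatrix : Bool × Bool → Matrix (Fin 3) (Fin 3) ℤ
  | (true, true) => !![1, -4, 0; 2, 1, 0; 0, 0, 3]
  | (true, false) => !![1, 4, 0; -2, 1, 0; 0, 0, 3]
  | (false, true) => !![3, 0, 0; 0, 1, -2; 0, 4, 1]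
  | (false, false) => !![3, 0, 0; 0, 1, 2; 0, -4, 1]

/-- A vector spanning the range of `integralMatrix x` modulo `3`. -/
def rangeVector : Bool × Bool → Fin 3 → ZMod 3
  | (true, true) => ![1, -1, 0]
  | (true, false) => ![1, 1, 0]
  | (false, true) => ![0, 1, 1]
  | (false, false) => ![0, 1, -1]

theorem integralMatrix_mod_three (x : Bool × Bool) :
    (integralMatrix x).map (Int.castRingHom (ZMod 3)) =
      vecMulVec (rangeVector x) (rangeVector x) := by
  revert x; decide

theorem rangeVector_ne_zero (x : Bool × Bool) : rangeVector x ≠ 0 := by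
  revert x; decide

theorem rangeVector_dotProduct_ne_zero (x y : Bool × Bool) (h : x.1 = y.1 → x.2 = y.2) :
    rangeVector x ⬝ᵥ rangeVector y ≠ 0 := by
  revert x y; decide

theorem exists_map_prod_integralMatrix_eq_vecMulVec (x : Bool × Bool) (L : List (Bool × Bool))
    (h : FreeGroup.IsReduced (x :: L)) :
    ∃ r : Fin 3 → ZMod 3, r ≠ 0 ∧
      ((x :: L).map integralMatrix).prod.map (Int.castRingHom (ZMod 3)) =
        vecMulVec (rangeVector x) r := by
  induction L generalizing x with
  | nil => exact ⟨rangeVector x, rangeVector_ne_zero x, by simpa using integralMatrix_mod_three x⟩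
  | cons y L ih =>
    rw [FreeGroup.isReduced_cons_cons] at h
    obtain ⟨r, hr, hL⟩ := ih y h.2
    refine ⟨(rangeVector x ⬝ᵥ rangeVector y) • r,
      smul_ne_zero (rangeVector_dotProduct_ne_zero x y h.1) hr, ?_⟩
    rw [List.map_cons, List.prod_cons, Matrix.map_mul, hL, integralMatrix_mod_three,
      vecMulVec_mul_vecMulVec]

theorem map_prod_integralMatrix_ne_zero {L : List (Bool × Bool)} (hL : L ≠ [])
    (h : FreeGroup.IsReduced L) :
    (L.map integralMatrix).prod.map (Int.castRingHom (ZMod 3)) ≠ 0 := by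
  obtain ⟨x, L, rfl⟩ := List.exists_cons_of_ne_nil hL
  obtain ⟨r, hr, hprod⟩ := exists_map_prod_integralMatrix_eq_vecMulVec x L h
  rw [hprod]
  exact vecMulVec_ne_zero (rangeVector_ne_zero x) hr

theorem letterRotation_mul_diagonal (x : Bool × Bool) :
    (3 : ℝ) • ((letterRotation x : Matrix (Fin 3) (Fin 3) ℝ) * diagonal ![1, √2, 1]) =
      diagonal ![1, √2, 1] * (integralMatrix x).map (Int.castRingHom ℝ) := by
  have h : √2 * √2 = (2 : ℝ) := Real.mul_self_sqrt (by norm_num)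
  obtain ⟨b, s⟩ := x
  have hinv : ((rotation b)⁻¹ : GL (Fin 3) ℝ).val = (rotationMatrix b)ᵀ := rfl
  have hval : (rotation b).val = rotationMatrix b := rfl
  cases s <;> simp only [letterRotation, cond_true, cond_false, hinv, hval] <;> cases b <;>
    ext i j <;> fin_cases i <;> fin_cases j <;>
    simp [rotationMatrix, integralMatrix, mul_diagonal, -cons_mul] <;> linarith

theorem prod_letterRotation_mul_diagonal (L : List (Bool × Bool)) :
    (3 : ℝ) ^ L.length •
        (((L.map letterRotation).prod : GL (Fin 3) ℝ).val * diagonal ![1, √2, 1]) =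
      diagonal ![1, √2, 1] * (L.map integralMatrix).prod.map (Int.castRingHom ℝ) := by
  induction L with
  | nil => simp
  | cons x L ih =>
    rw [List.map_cons, List.prod_cons, List.map_cons, List.prod_cons, Matrix.map_mul,
      ← Matrix.mul_assoc, ← letterRotation_mul_diagonal, smul_mul_assoc, Matrix.mul_assoc, ← ih,
      List.length_cons, pow_succ', mul_smul, Units.val_mul, Matrix.mul_assoc, mul_smul_comm]

theorem prod_integralMatrix_of_prod_letterRotation_eq_one {L : List (Bool × Bool)}
    (h : (L.map letterRotation).prod = 1) :
    (L.map integralMatrix).prod = (3 : ℤ) ^ L.length • 1 := by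
  have hL := prod_letterRotation_mul_diagonal L
  rw [h, Units.val_one, one_mul] at hL
  ext i j
  have hij := congrFun₂ hL i j
  have hd : (![1, √2, 1] : Fin 3 → ℝ) i ≠ 0 := by fin_cases i <;> simp
  rw [diagonal_mul, Matrix.smul_apply, smul_eq_mul, diagonal_apply] at hij
  have key : (((L.map integralMatrix).prod i j : ℤ) : ℝ) = 3 ^ L.length * if i = j then 1 else 0 :=
    mul_left_cancel₀ hd (hij.symm.trans (by split_ifs <;> ring))
  rw [Matrix.smul_apply, smul_eq_mul, one_apply]
  exact_mod_cast key

theorem lift_rotation_injective : Function.Injective (FreeGroup.lift rotation) := by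
  refine (injective_iff_map_eq_one _).2 fun w hw => ?_
  by_contra hne
  have hnil : w.toWord ≠ [] := mt FreeGroup.toWord_eq_nil_iff.1 hne
  refine map_prod_integralMatrix_ne_zero hnil FreeGroup.isReduced_toWord ?_
  rw [← FreeGroup.mk_toWord (x := w), FreeGroup.lift_mk] at hw
  rw [prod_integralMatrix_of_prod_letterRotation_eq_one hw]
  have h3 : (3 : ZMod 3) = 0 := rfl
  ext i j
  rw [map_apply, Matrix.smul_apply]
  simp [h3, hne]

end Swierczkowski

/-- **Świerczkowski: `SO(3)` contains a free subgroup of rank two.**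
The rotations `φ` (about the `z`-axis) and `ρ` (about the `x`-axis) by the angle
`arccos (1/3)` lie in `SO(3)` and generate a free group on the two generators `φ, ρ`:
the induced homomorphism from the free group on two generators is injective. -/
theorem so3_has_free_subgroup_of_rank_two :
    ∃ φ ρ : GL (Fin 3) ℝ,
      (↑φ : Matrix (Fin 3) (Fin 3) ℝ) =
        !![1/3, -(2*Real.sqrt 2)/3, 0;
           (2*Real.sqrt 2)/3, 1/3, 0;
           0, 0, 1] ∧
      (↑ρ : Matrix (Fin 3) (Fin 3) ℝ) =
        !![1, 0, 0;
           0, 1/3, -(2*Real.sqrt 2)/3;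
           0, (2*Real.sqrt 2)/3, 1/3] ∧
      (↑φ : Matrix (Fin 3) (Fin 3) ℝ) ∈ Matrix.specialOrthogonalGroup (Fin 3) ℝ ∧
      (↑ρ : Matrix (Fin 3) (Fin 3) ℝ) ∈ Matrix.specialOrthogonalGroup (Fin 3) ℝ ∧
      Function.Injective
        (FreeGroup.lift (fun b : Bool => if b then φ else ρ) :
          FreeGroup Bool →* GL (Fin 3) ℝ) := by
  have hrot : (fun b : Bool => if b then Swierczkowski.rotation true
      else Swierczkowski.rotation false) = Swierczkowski.rotation := by
    ext1 b; cases b <;> rfl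
  exact ⟨Swierczkowski.rotation true, Swierczkowski.rotation false, rfl, rfl,
    Swierczkowski.rotationMatrix_mem_specialOrthogonalGroup true,
    Swierczkowski.rotationMatrix_mem_specialOrthogonalGroup false,
    hrot ▸ Swierczkowski.lift_rotation_injective⟩
end

section
/- Let P ⊆ S¹ be a countable subset of the unit circle and, for α ∈ [0, 2π), let τ_α ∈ SO(2) be the rotation by angle α. Then for all but countably many α ∈ [0, 2π), the set ⋃_{n=1}^∞ τ_αⁿ(P) is disjoint from P. -/
/-- The rotation of the plane `ℝ²` by the angle `θ`. -/
noncomputable def rot (θ : ℝ) (x : EuclideanSpace ℝ (Fin 2)) : EuclideanSpace ℝ (Fin 2) :=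
  Matrix.toEuclideanLin !![Real.cos θ, -Real.sin θ; Real.sin θ, Real.cos θ] x

theorem rot_apply_zero (θ : ℝ) (x : EuclideanSpace ℝ (Fin 2)) :
    rot θ x 0 = Real.cos θ * x 0 - Real.sin θ * x 1 := by
  simp [rot, Matrix.toLpLin_apply, dotProduct, Fin.sum_univ_two]
  ring

theorem rot_apply_one (θ : ℝ) (x : EuclideanSpace ℝ (Fin 2)) :
    rot θ x 1 = Real.sin θ * x 0 + Real.cos θ * x 1 := by
  simp [rot, Matrix.toLpLin_apply, dotProduct, Fin.sum_univ_two]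

theorem rot_zero (x : EuclideanSpace ℝ (Fin 2)) : rot 0 x = x := by
  ext i
  fin_cases i
  · simpa using rot_apply_zero 0 x
  · simpa using rot_apply_one 0 x

theorem rot_rot (θ φ : ℝ) (x : EuclideanSpace ℝ (Fin 2)) :
    rot θ (rot φ x) = rot (θ + φ) x := by
  ext i
  fin_cases i
  · change rot θ (rot φ x) 0 = rot (θ + φ) x 0
    simp only [rot_apply_zero, rot_apply_one, Real.cos_add, Real.sin_add]
    ring
  · change rot θ (rot φ x) 1 = rot (θ + φ) x 1
    simp only [rot_apply_zero, rot_apply_one, Real.cos_add, Real.sin_add]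
    ring

theorem rot_iterate (θ : ℝ) (n : ℕ) (x : EuclideanSpace ℝ (Fin 2)) :
    (rot θ)^[n] x = rot (n * θ) x := by
  induction n with
  | zero => simp [rot_zero]
  | succ n ih =>
    rw [Function.iterate_succ_apply', ih, rot_rot]
    congr 1
    push_cast
    ring

/-- Two rotations that agree at a nonzero vector have angles differing by a multiple of `2π`. -/
theorem exists_sub_eq_of_rot_eq {θ φ : ℝ} {x : EuclideanSpace ℝ (Fin 2)} (hx : x ≠ 0)
    (h : rot θ x = rot φ x) : ∃ k : ℤ, θ - φ = 2 * Real.pi * k := by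
  have h0 : rot θ x 0 = rot φ x 0 := by rw [h]
  have h1 : rot θ x 1 = rot φ x 1 := by rw [h]
  rw [rot_apply_zero, rot_apply_zero] at h0
  rw [rot_apply_one, rot_apply_one] at h1
  have hne : x 0 ^ 2 + x 1 ^ 2 ≠ 0 := by
    intro hsq
    apply hx
    ext i
    fin_cases i
    · change x 0 = 0
      nlinarith [sq_nonneg (x 0), sq_nonneg (x 1)]
    · change x 1 = 0
      nlinarith [sq_nonneg (x 0), sq_nonneg (x 1)]
  rw [← Real.Angle.angle_eq_iff_two_pi_dvd_sub]
  apply Real.Angle.cos_sin_inj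
  · apply mul_right_cancel₀ hne
    linear_combination x 0 * h0 + x 1 * h1
  · apply mul_right_cancel₀ hne
    linear_combination x 0 * h1 - x 1 * h0

theorem countable_setOf_rot_eq {x : EuclideanSpace ℝ (Fin 2)} (hx : x ≠ 0)
    (y : EuclideanSpace ℝ (Fin 2)) : {θ : ℝ | rot θ x = y}.Countable := by
  rcases Set.eq_empty_or_nonempty {θ : ℝ | rot θ x = y} with h | ⟨φ, hφ⟩
  · simp [h]
  · refine (Set.countable_range fun k : ℤ => φ + 2 * Real.pi * k).mono fun θ hθ => ?_
    obtain ⟨k, hk⟩ := exists_sub_eq_of_rot_eq hx (Eq.trans hθ (Eq.symm hφ))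
    exact ⟨k, by linarith⟩

theorem countable_setOf_rot_iterate_eq {n : ℕ} (hn : n ≠ 0) {x : EuclideanSpace ℝ (Fin 2)}
    (hx : x ≠ 0) (y : EuclideanSpace ℝ (Fin 2)) : {θ : ℝ | (rot θ)^[n] x = y}.Countable := by
  simp only [rot_iterate]
  exact (countable_setOf_rot_eq hx y).preimage (mul_right_injective₀ (Nat.cast_ne_zero.mpr hn))

/-- For a countable subset `P` of the unit circle `S¹`, for all but countably many angles
`α ∈ [0, 2π)` the set `⋃_{n ≥ 1} τ_αⁿ(P)` is disjoint from `P`, where `τ_α` is the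
rotation by `α`. -/
theorem countable_bad_angles
    (P : Set (EuclideanSpace ℝ (Fin 2))) (hP : P.Countable)
    (hPS : P ⊆ Metric.sphere (0 : EuclideanSpace ℝ (Fin 2)) 1) :
    {α ∈ Set.Ico 0 (2 * Real.pi) |
      ¬ Disjoint (⋃ n : ℕ, ⋃ _ : 1 ≤ n, (rot α)^[n] '' P) P}.Countable := by
  have hne : ∀ x ∈ P, x ≠ 0 := fun x hx => ne_zero_of_mem_unit_sphere ⟨x, hPS hx⟩
  have hbad : (⋃ n ∈ {n : ℕ | 1 ≤ n}, ⋃ x ∈ P, ⋃ y ∈ P,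
      {α : ℝ | (rot α)^[n] x = y}).Countable :=
    (Set.to_countable _).biUnion fun n hn => hP.biUnion fun x hx => hP.biUnion fun y _ =>
      countable_setOf_rot_iterate_eq (Nat.one_le_iff_ne_zero.mp hn) (hne x hx) y
  refine hbad.mono ?_
  rintro α ⟨-, hα⟩
  obtain ⟨y, hy, hyP⟩ := Set.not_disjoint_iff.mp hα
  simp only [Set.mem_iUnion] at hy
  obtain ⟨n, hn, x, hx, rfl⟩ := hy
  simp only [Set.mem_iUnion]
  exact ⟨n, hn, x, hx, _, hyP, rfl⟩
end

section
/- Let P ⊆ S² be a countable subset of the unit sphere in ℝ³. Then there exist a countable set Q and a rotation ω ∈ SO(3) such that P ⊆ Q ⊆ S² and ω(Q) = Q \ P. -/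
/-- The action of `SO(3)` on `ℝ³`. -/
noncomputable def so3Act (g : Matrix.specialOrthogonalGroup (Fin 3) ℝ)
    (x : EuclideanSpace ℝ (Fin 3)) : EuclideanSpace ℝ (Fin 3) :=
  Matrix.toEuclideanLin (g : Matrix (Fin 3) (Fin 3) ℝ) x

theorem so3Act_one (x : EuclideanSpace ℝ (Fin 3)) : so3Act 1 x = x := by
  simp [so3Act, Matrix.toLpLin_one]

theorem so3Act_mul (g h : Matrix.specialOrthogonalGroup (Fin 3) ℝ)
    (x : EuclideanSpace ℝ (Fin 3)) : so3Act (g * h) x = so3Act g (so3Act h x) := by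
  simp [so3Act, Matrix.toLpLin_apply]

theorem norm_so3Act (g : Matrix.specialOrthogonalGroup (Fin 3) ℝ)
    (x : EuclideanSpace ℝ (Fin 3)) : ‖so3Act g x‖ = ‖x‖ := by
  have hg : (g : Matrix (Fin 3) (Fin 3) ℝ).transpose * g = 1 :=
    (Matrix.mem_orthogonalGroup_iff' (Fin 3) ℝ).1 (Matrix.mem_specialOrthogonalGroup_iff.1 g.2).1
  have key : (so3Act g x).ofLp ⬝ᵥ (so3Act g x).ofLp = x.ofLp ⬝ᵥ x.ofLp := by
    simp only [so3Act, Matrix.toLpLin_apply]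
    rw [Matrix.dotProduct_mulVec, ← Matrix.mulVec_transpose, Matrix.mulVec_mulVec, hg,
      Matrix.one_mulVec]
  rw [EuclideanSpace.norm_eq, EuclideanSpace.norm_eq]
  congr 1
  simpa [dotProduct, pow_two] using key

theorem countable_setOf_cos_sin_mul_eq {r : ℝ} (hr : r ≠ 0) (a b : ℝ) :
    {t : ℝ | Real.cos (r * t) = a ∧ Real.sin (r * t) = b}.Countable := by
  rcases Set.eq_empty_or_nonempty {t : ℝ | Real.cos (r * t) = a ∧ Real.sin (r * t) = b}
    with h | ⟨t₀, hc₀, hs₀⟩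
  · simp [h]
  · refine (Set.countable_range fun k : ℤ => t₀ + k * (2 * Real.pi) / r).mono ?_
    rintro t ⟨hc, hs⟩
    have h : Real.cos (r * t - r * t₀) = 1 := by
      rw [Real.cos_sub, hc, hs, hc₀, hs₀, ← hc₀, ← hs₀]
      nlinarith [Real.sin_sq_add_cos_sq (r * t₀)]
    obtain ⟨k, hk⟩ := (Real.cos_eq_one_iff _).1 h
    refine ⟨k, ?_⟩
    simp only [hk]
    field_simp
    ring

/-- The rotation by the angle `t` about the first coordinate axis. -/
noncomputable def rotX (t : ℝ) : Matrix.specialOrthogonalGroup (Fin 3) ℝ :=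
  ⟨!![1, 0, 0; 0, Real.cos t, -Real.sin t; 0, Real.sin t, Real.cos t], by
    have h := Real.sin_sq_add_cos_sq t
    rw [Matrix.mem_specialOrthogonalGroup_iff, Matrix.mem_orthogonalGroup_iff]
    constructor
    · ext i j
      fin_cases i <;> fin_cases j <;> simp [Matrix.mul_apply, Fin.sum_univ_three] <;> linarith
    · simp [Matrix.det_fin_three]
      linarith⟩

/-- The rotation by the angle `t` about the third coordinate axis. -/
noncomputable def rotZ (t : ℝ) : Matrix.specialOrthogonalGroup (Fin 3) ℝ :=
  ⟨!![Real.cos t, -Real.sin t, 0; Real.sin t, Real.cos t, 0; 0, 0, 1], by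
    have h := Real.sin_sq_add_cos_sq t
    rw [Matrix.mem_specialOrthogonalGroup_iff, Matrix.mem_orthogonalGroup_iff]
    constructor
    · ext i j
      fin_cases i <;> fin_cases j <;> simp [Matrix.mul_apply, Fin.sum_univ_three] <;> linarith
    · simp [Matrix.det_fin_three]
      linarith⟩

theorem rotX_add (s t : ℝ) : rotX (s + t) = rotX s * rotX t := by
  apply Subtype.ext
  ext i j
  fin_cases i <;> fin_cases j <;>
    simp [rotX, Real.cos_add, Real.sin_add] <;> ring

theorem rotX_zero : rotX 0 = 1 := by
  apply Subtype.ext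
  ext i j
  fin_cases i <;> fin_cases j <;> simp [rotX]

theorem rotX_pow (t : ℝ) (n : ℕ) : rotX t ^ n = rotX (n * t) := by
  induction n with
  | zero => simp [rotX_zero]
  | succ n ih => rw [pow_succ, ih, ← rotX_add]; push_cast; ring_nf

theorem so3Act_rotX_one (t : ℝ) (x : EuclideanSpace ℝ (Fin 3)) :
    so3Act (rotX t) x 1 = Real.cos t * x 1 - Real.sin t * x 2 := by
  simp [so3Act, rotX, Matrix.toLpLin_apply, dotProduct, Fin.sum_univ_three]
  ring

theorem so3Act_rotX_two (t : ℝ) (x : EuclideanSpace ℝ (Fin 3)) :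
    so3Act (rotX t) x 2 = Real.sin t * x 1 + Real.cos t * x 2 := by
  simp [so3Act, rotX, Matrix.toLpLin_apply, dotProduct, Fin.sum_univ_three]

theorem countable_setOf_rotX_mul {r : ℝ} (hr : r ≠ 0) {x : EuclideanSpace ℝ (Fin 3)}
    (hx : ¬ (x 1 = 0 ∧ x 2 = 0)) (y : EuclideanSpace ℝ (Fin 3)) :
    {t : ℝ | so3Act (rotX (r * t)) x = y}.Countable := by
  have hd : x 1 ^ 2 + x 2 ^ 2 ≠ 0 := fun h =>
    hx ⟨by nlinarith [sq_nonneg (x 1), sq_nonneg (x 2)],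
      by nlinarith [sq_nonneg (x 1), sq_nonneg (x 2)]⟩
  refine (countable_setOf_cos_sin_mul_eq hr
    ((x 1 * y 1 + x 2 * y 2) / (x 1 ^ 2 + x 2 ^ 2))
    ((x 1 * y 2 - x 2 * y 1) / (x 1 ^ 2 + x 2 ^ 2))).mono ?_
  rintro t rfl
  rw [Set.mem_ofPred_eq, so3Act_rotX_one, so3Act_rotX_two, eq_div_iff hd, eq_div_iff hd]
  constructor <;> ring

theorem countable_setOf_rotZ_mem_axis (p : EuclideanSpace ℝ (Fin 3)) (hp : ‖p‖ = 1) :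
    {t : ℝ | so3Act (rotZ t) p 1 = 0 ∧ so3Act (rotZ t) p 2 = 0}.Countable := by
  refine ((countable_setOf_cos_sin_mul_eq one_ne_zero (p 0) (-p 1)).union
    (countable_setOf_cos_sin_mul_eq one_ne_zero (-p 0) (p 1))).mono ?_
  rintro t ⟨h1, h2⟩
  have hn : p 0 ^ 2 + p 1 ^ 2 + p 2 ^ 2 = 1 := by
    have := EuclideanSpace.real_norm_sq_eq p
    rw [hp, Fin.sum_univ_three] at this
    linarith
  simp [so3Act, rotZ, Matrix.toLpLin_apply, dotProduct, Fin.sum_univ_three]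
    at h1 h2
  have hcs := Real.sin_sq_add_cos_sq t
  set c := Real.cos t
  set s := Real.sin t
  have h0 : p 0 = c * (c * p 0 - s * p 1) := by linear_combination (-p 0) * hcs + s * h1
  have h1' : p 1 = -s * (c * p 0 - s * p 1) := by linear_combination (-p 1) * hcs + c * h1
  have hsq : (c * p 0 - s * p 1) ^ 2 = 1 := by
    rw [h2] at hn
    linear_combination hn - (s * p 0 + c * p 1) * h1 + (p 0 ^ 2 + p 1 ^ 2) * hcs
  rcases sq_eq_sq_iff_eq_or_eq_neg.1 (hsq.trans (one_pow 2).symm) with h | h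
  · left
    rw [h] at h0 h1'
    simp only [Set.mem_ofPred_eq, one_mul]
    constructor <;> linarith
  · right
    rw [h] at h0 h1'
    simp only [Set.mem_ofPred_eq, one_mul]
    constructor <;> linarith

/-- A rotation all of whose positive powers move `P` off itself yields an absorbing set. -/
theorem so3Act_image_iUnion_pow {P : Set (EuclideanSpace ℝ (Fin 3))}
    {ω : Matrix.specialOrthogonalGroup (Fin 3) ℝ}
    (h : ∀ n : ℕ, ∀ p ∈ P, ∀ q ∈ P, so3Act (ω ^ (n + 1)) p ≠ q) :
    so3Act ω '' (⋃ n : ℕ, so3Act (ω ^ n) '' P) = (⋃ n : ℕ, so3Act (ω ^ n) '' P) \ P := by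
  ext y
  simp only [Set.mem_image, Set.mem_iUnion, Set.mem_sdiff]
  constructor
  · rintro ⟨_, ⟨n, p, hp, rfl⟩, rfl⟩
    rw [← so3Act_mul, ← pow_succ']
    exact ⟨⟨n + 1, p, hp, rfl⟩, fun hq => h n p hp _ hq rfl⟩
  · rintro ⟨⟨n, p, hp, rfl⟩, hy⟩
    cases n with
    | zero => exact absurd (by simpa [so3Act_one] using hp) hy
    | succ n => exact ⟨_, ⟨n, p, hp, rfl⟩, by rw [← so3Act_mul, ← pow_succ']⟩

theorem exists_rotation_pow_ne {P : Set (EuclideanSpace ℝ (Fin 3))} (hP : P.Countable)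
    (hPS : P ⊆ Metric.sphere (0 : EuclideanSpace ℝ (Fin 3)) 1) :
    ∃ ω : Matrix.specialOrthogonalGroup (Fin 3) ℝ,
      ∀ n : ℕ, ∀ p ∈ P, ∀ q ∈ P, so3Act (ω ^ (n + 1)) p ≠ q := by
  obtain ⟨s, hs⟩ : ∃ s, s ∉ ⋃ p ∈ P,
      {t : ℝ | so3Act (rotZ t) p 1 = 0 ∧ so3Act (rotZ t) p 2 = 0} :=
    (Set.ne_univ_iff_exists_notMem _).1 fun h => Cardinal.not_countable_real <| h ▸
      hP.biUnion fun p hp => countable_setOf_rotZ_mem_axis p (by simpa using hPS hp)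
  simp only [Set.mem_iUnion, not_exists] at hs
  obtain ⟨t, ht⟩ : ∃ t, t ∉ ⋃ n : ℕ, ⋃ p ∈ P, ⋃ q ∈ P,
      {t : ℝ | so3Act (rotX (((n + 1 : ℕ) : ℝ) * t)) (so3Act (rotZ s) p)
        = so3Act (rotZ s) q} :=
    (Set.ne_univ_iff_exists_notMem _).1 fun h => Cardinal.not_countable_real <| h ▸
      Set.countable_iUnion fun n => hP.biUnion fun p hp => hP.biUnion fun q _ =>
        countable_setOf_rotX_mul (Nat.cast_ne_zero.2 n.succ_ne_zero) (hs p hp) _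
  simp only [Set.mem_iUnion, not_exists] at ht
  refine ⟨(rotZ s)⁻¹ * rotX t * rotZ s, fun n p hp q hq h => ht n p hp q hq ?_⟩
  have hpow : ((rotZ s)⁻¹ * rotX t * rotZ s) ^ (n + 1)
      = (rotZ s)⁻¹ * rotX t ^ (n + 1) * rotZ s := by
    simpa using conj_pow (i := n + 1) (a := (rotZ s)⁻¹) (b := rotX t)
  rw [Set.mem_ofPred_eq, ← h, hpow, ← so3Act_mul, ← so3Act_mul, ← rotX_pow]
  congr 1
  group

/-- For every countable subset `P` of the unit sphere `S² ⊆ ℝ³` there are a countable set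
`Q` with `P ⊆ Q ⊆ S²` and a rotation `ω ∈ SO(3)` with `ω(Q) = Q \ P`. -/
theorem absorbing_rotation_exists
    (P : Set (EuclideanSpace ℝ (Fin 3))) (hP : P.Countable)
    (hPS : P ⊆ Metric.sphere (0 : EuclideanSpace ℝ (Fin 3)) 1) :
    ∃ (Q : Set (EuclideanSpace ℝ (Fin 3))) (ω : Matrix.specialOrthogonalGroup (Fin 3) ℝ),
      Q.Countable ∧ P ⊆ Q ∧ Q ⊆ Metric.sphere (0 : EuclideanSpace ℝ (Fin 3)) 1 ∧
      so3Act ω '' Q = Q \ P := by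
  obtain ⟨ω, hω⟩ := exists_rotation_pow_ne hP hPS
  refine ⟨⋃ n : ℕ, so3Act (ω ^ n) '' P, ω, Set.countable_iUnion fun n => hP.image _,
    fun p hp => Set.mem_iUnion.2 ⟨0, p, hp, by rw [pow_zero, so3Act_one]⟩,
    Set.iUnion_subset fun n => ?_, so3Act_image_iUnion_pow hω⟩
  rintro _ ⟨p, hp, rfl⟩
  simpa [norm_so3Act] using hPS hp
end

section
/- There exist a countable set N ⊆ B³ with 0 ∈ N and an isometry r of ℝ³ (a composition of rotations and translations) such that r(N) = N \ {0}. -/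
/-- The rotation of `ℝ³` by the angle `θ` about the axis through `(1/2, 0, 0)` parallel to the
third coordinate axis. -/
noncomputable def offsetRotation (θ : ℝ) (x : EuclideanSpace ℝ (Fin 3)) :
    EuclideanSpace ℝ (Fin 3) :=
  !₂[1 / 2 + (Real.cos θ * (x 0 - 1 / 2) - Real.sin θ * x 1),
    Real.sin θ * (x 0 - 1 / 2) + Real.cos θ * x 1, x 2]

theorem offsetRotation_add (θ φ : ℝ) (x : EuclideanSpace ℝ (Fin 3)) :
    offsetRotation (θ + φ) x = offsetRotation θ (offsetRotation φ x) := by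
  ext i
  fin_cases i <;> simp [offsetRotation, Real.cos_add, Real.sin_add] <;> ring

theorem offsetRotation_zero_angle (x : EuclideanSpace ℝ (Fin 3)) : offsetRotation 0 x = x := by
  ext i
  fin_cases i <;> simp [offsetRotation]

theorem isometry_offsetRotation (θ : ℝ) : Isometry (offsetRotation θ) := by
  refine Isometry.of_dist_eq fun x y => ?_
  simp only [EuclideanSpace.dist_eq, Fin.sum_univ_three, Real.dist_eq, sq_abs]
  congr 1
  simp [offsetRotation]
  linear_combination ((x 0 - y 0) ^ 2 + (x 1 - y 1) ^ 2) * Real.sin_sq_add_cos_sq θ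

/-- `offsetRotation θ` as an isometric bijection, with inverse `offsetRotation (-θ)`. -/
noncomputable def offsetRotationEquiv (θ : ℝ) :
    EuclideanSpace ℝ (Fin 3) ≃ᵢ EuclideanSpace ℝ (Fin 3) :=
  IsometryEquiv.mk' (offsetRotation θ) (offsetRotation (-θ))
    (fun x => by rw [← offsetRotation_add, add_neg_cancel, offsetRotation_zero_angle])
    (isometry_offsetRotation θ)

theorem norm_offsetRotation_zero_le (θ : ℝ) : ‖offsetRotation θ 0‖ ≤ 1 := by
  rw [EuclideanSpace.norm_eq, Real.sqrt_le_one]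
  simp [Fin.sum_univ_three, offsetRotation]
  nlinarith [Real.sin_sq_add_cos_sq θ, Real.neg_one_le_cos θ]

theorem offsetRotation_natCast_ne_zero {n : ℕ} (hn : n ≠ 0) : offsetRotation n 0 ≠ 0 := by
  intro h
  have h0 : Real.cos n = 1 := by
    have := congrArg (fun x : EuclideanSpace ℝ (Fin 3) => x 0) h
    simp [offsetRotation] at this
    linarith
  obtain ⟨k, hk⟩ := (Real.cos_eq_one_iff _).1 h0
  have hk0 : (k : ℝ) ≠ 0 := by
    intro hk0
    rw [hk0, zero_mul] at hk
    exact hn (by exact_mod_cast hk.symm)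
  refine irrational_pi ⟨(n : ℚ) / (2 * k), ?_⟩
  push_cast
  rw [← hk]
  field_simp

/-- There are a countable set `N ⊆ B³` with `0 ∈ N` and an isometry `r` of `ℝ³` with
`r(N) = N \ {0}`. -/
theorem absorbing_isometry_exists :
    ∃ N : Set (EuclideanSpace ℝ (Fin 3)), N.Countable ∧ (0 : EuclideanSpace ℝ (Fin 3)) ∈ N ∧
      N ⊆ Metric.closedBall (0 : EuclideanSpace ℝ (Fin 3)) 1 ∧
      ∃ r : EuclideanSpace ℝ (Fin 3) ≃ᵢ EuclideanSpace ℝ (Fin 3),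
        r '' N = N \ {(0 : EuclideanSpace ℝ (Fin 3))} := by
  have hr (n : ℕ) : offsetRotationEquiv 1 (offsetRotation n 0) = offsetRotation (n + 1 : ℕ) 0 := by
    rw [Nat.cast_succ, add_comm, offsetRotation_add]
    rfl
  have h0 : offsetRotation (0 : ℕ) 0 = 0 := by
    rw [Nat.cast_zero, offsetRotation_zero_angle]
  refine ⟨Set.range fun n : ℕ => offsetRotation n 0, Set.countable_range _, ⟨0, h0⟩, ?_,
    offsetRotationEquiv 1, ?_⟩
  · rintro _ ⟨n, rfl⟩
    exact mem_closedBall_zero_iff.2 (norm_offsetRotation_zero_le n)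
  · ext x
    constructor
    · rintro ⟨_, ⟨n, rfl⟩, rfl⟩
      exact ⟨⟨n + 1, (hr n).symm⟩, by
        simpa only [hr, Set.mem_singleton_iff] using
          offsetRotation_natCast_ne_zero n.succ_ne_zero⟩
    · rintro ⟨⟨_ | n, rfl⟩, hn⟩
      · exact absurd h0 hn
      · exact ⟨_, ⟨n, rfl⟩, hr n⟩
end
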